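/- For each of the Banach spaces Ω ∈ { c_0, c, l^α for 1 ≤ α < ∞, l^∞ } of complex sequences indexed by the nonnegative integers, the spectrum of the transition operator S acting on Ω is contained in the fibered filled Julia set E. -/

import Mathlib

open Filter Finset
open scoped ENNReal Topology ZeroAtInfty

noncomputable section

namespace AMFC

/-- `q d j = d 0 * d 1 * ... * d j`. -/
def q (d : ℕ → ℕ) (j : ℕ) : ℕ := ∏ i ∈ Finset.range (j + 1), d i

/-- For `j ≥ 1`, `digit d n j = ⌊n / q_{j-1}⌋ mod d_j` is the `j`-th digit of `n`
in the Cantor system of numeration. -/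
def digit (d : ℕ → ℕ) (n j : ℕ) : ℕ := (n / q d (j - 1)) % d j

/-- The counter `ζ_n = min { j ≥ 1 : a_j(n) ≠ d_j - 1 }`. -/
def zeta (d : ℕ → ℕ) (n : ℕ) : ℕ := sInf {j | 1 ≤ j ∧ digit d n j ≠ d j - 1}

open scoped Classical in
/-- The transition probabilities of the stochastic adding machine. -/
def s (d : ℕ → ℕ) (p : ℕ → ℝ) (n m : ℕ) : ℝ :=
  if m = n + 1 then ∏ j ∈ Finset.Icc 1 (zeta d n), p j
  else if m = n then 1 - p 1
  else if h : ∃ r, 1 ≤ r ∧ r + 1 ≤ zeta d n ∧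
      n = m + ∑ j ∈ Finset.Icc 1 r, (d j - 1) * q d (j - 1)
    then (1 - p (h.choose + 1)) * ∏ j ∈ Finset.Icc 1 h.choose, p j
  else 0

/-- `f j (z) = ((z - (1 - p j)) / p j) ^ (d j)`. -/
def f (d : ℕ → ℕ) (p : ℕ → ℝ) (j : ℕ) (z : ℂ) : ℂ :=
  ((z - (1 - (p j : ℂ))) / (p j : ℂ)) ^ d j

/-- `ftil j = f j ∘ ... ∘ f 1`, with `ftil 0 = id`. -/
def ftil (d : ℕ → ℕ) (p : ℕ → ℝ) : ℕ → ℂ → ℂ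
  | 0 => id
  | j + 1 => f d p (j + 1) ∘ ftil d p j

/-- The fibered filled Julia set `E = {z : limsup_j |ftil j z| < ∞}`. -/
def E (d : ℕ → ℕ) (p : ℕ → ℝ) : Set ℂ :=
  {z | Filter.limsup (fun j => (‖ftil d p j z‖₊ : ℝ≥0∞)) Filter.atTop < ⊤}

/-- `ι_λ(r) = (ftil (r-1) λ - (1 - p r)) / p r` for `r ≥ 1`. -/
def iota (d : ℕ → ℕ) (p : ℕ → ℝ) (lam : ℂ) (r : ℕ) : ℂ :=
  (ftil d p (r - 1) lam - (1 - (p r : ℂ))) / (p r : ℂ)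

/-- `v_λ(n) = ∏_{r ≥ 1} ι_λ(r) ^ a_r(n)`, a finite product. -/
def vlam (d : ℕ → ℕ) (p : ℕ → ℝ) (lam : ℂ) (n : ℕ) : ℂ :=
  ∏ᶠ r : ℕ, iota d p lam (r + 1) ^ digit d n (r + 1)

/-- The point spectrum of a continuous linear operator. -/
def pointSpectrum {M : Type*} [NormedAddCommGroup M] [NormedSpace ℂ M]
    (T : M →L[ℂ] M) : Set ℂ :=
  {lam | ∃ v, v ≠ 0 ∧ T v = lam • v}

/-- The residual spectrum: `T - λI` is injective but its range is not dense. -/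
def residualSpectrum {M : Type*} [NormedAddCommGroup M] [NormedSpace ℂ M]
    (T : M →L[ℂ] M) : Set ℂ :=
  {lam | Function.Injective ⇑(T - lam • (1 : M →L[ℂ] M)) ∧
    ¬ DenseRange ⇑(T - lam • (1 : M →L[ℂ] M))}

/-- The continuous spectrum: `T - λI` is injective with dense range, but not surjective. -/
def continuousSpectrum {M : Type*} [NormedAddCommGroup M] [NormedSpace ℂ M]
    (T : M →L[ℂ] M) : Set ℂ :=
  {lam | Function.Injective ⇑(T - lam • (1 : M →L[ℂ] M)) ∧
    DenseRange ⇑(T - lam • (1 : M →L[ℂ] M)) ∧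
    Set.range ⇑(T - lam • (1 : M →L[ℂ] M)) ≠ Set.univ}


/-- the shifted sequence of bases -/
def sh (d : ℕ → ℕ) : ℕ → ℕ := fun j => if j = 0 then 1 else d (j + 1)

/-- the shifted sequence of probabilities -/
def shp (p : ℕ → ℝ) : ℕ → ℝ := fun j => p (j + 1)

/-- admissible parameters -/
structure Adm (d : ℕ → ℕ) (p : ℕ → ℝ) : Prop where
  d0 : d 0 = 1
  dj : ∀ j, 1 ≤ j → 2 ≤ d j
  pj : ∀ j, 1 ≤ j → p j ∈ Set.Ioc (0 : ℝ) 1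

variable {d : ℕ → ℕ} {p : ℕ → ℝ}

lemma Adm.shift (h : Adm d p) : Adm (sh d) (shp p) := by
  refine ⟨by simp [sh], fun j hj => ?_, fun j hj => h.pj (j + 1) (by omega)⟩
  have : j ≠ 0 := by omega
  simpa [sh, this] using h.dj (j + 1) (by omega)

lemma q_succ (d : ℕ → ℕ) (j : ℕ) : q d (j + 1) = q d j * d (j + 1) := by
  simp [q, Finset.prod_range_succ]

lemma q_shift (h : Adm d p) (j : ℕ) : q d (j + 1) = d 1 * q (sh d) j := by
  induction j with
  | zero => simp [q, Finset.prod_range_succ, h.d0, sh]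
  | succ j ih => rw [q_succ, ih, q_succ, mul_assoc]; simp [sh]

lemma q_zero (h : Adm d p) : q d 0 = 1 := by simp [q, h.d0]

lemma digit_one (h : Adm d p) (n : ℕ) : digit d n 1 = n % d 1 := by
  simp [digit, q_zero h]

lemma digit_shift (h : Adm d p) (n j : ℕ) (hj : 1 ≤ j) :
    digit d n (j + 1) = digit (sh d) (n / d 1) j := by
  obtain ⟨i, rfl⟩ : ∃ i, j = i + 1 := ⟨j - 1, by omega⟩
  simp [digit, q_shift h, Nat.div_div_eq_div_mul, sh]

lemma lt_q (h : Adm d p) (j : ℕ) : j < q d j := by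
  induction j with
  | zero => simp [q_zero h]
  | succ j ih => rw [q_succ]; nlinarith [h.dj (j + 1) (by omega)]

lemma zset_nonempty (h : Adm d p) (n : ℕ) :
    {j | 1 ≤ j ∧ digit d n j ≠ d j - 1}.Nonempty := by
  refine ⟨n + 1, by omega, ?_⟩
  have := lt_q h n
  have h2 := h.dj (n + 1) (by omega)
  simp only [digit, Nat.add_sub_cancel, Nat.div_eq_of_lt this, Nat.zero_mod]
  omega

lemma one_le_zeta (h : Adm d p) (n : ℕ) : 1 ≤ zeta d n :=
  (Nat.sInf_mem (zset_nonempty h n)).1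

lemma zeta_one (h : Adm d p) (n : ℕ) (hn : n % d 1 ≠ d 1 - 1) : zeta d n = 1 := by
  refine le_antisymm (Nat.sInf_le ⟨le_rfl, ?_⟩) (one_le_zeta h n)
  rwa [digit_one h]

lemma zeta_shift (h : Adm d p) (n : ℕ) (hn : n % d 1 = d 1 - 1) :
    zeta d n = zeta (sh d) (n / d 1) + 1 := by
  have := Nat.sInf_add (n := 1) (p := fun j => 1 ≤ j ∧ digit d n j ≠ d j - 1)
    (one_le_zeta h n)
  rw [zeta, ← this, zeta]
  congr 2
  ext m
  simp only [Set.mem_ofPred_eq]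
  rcases Nat.eq_zero_or_pos m with rfl | hm
  · simp [digit_one h, hn]
  · have : m ≠ 0 := by omega
    rw [digit_shift h n m hm]
    simp [sh, this]
    omega

/-- the carry sum -/
def csum (d : ℕ → ℕ) (r : ℕ) : ℕ := ∑ j ∈ Finset.Icc 1 r, (d j - 1) * q d (j - 1)

lemma csum_succ (d : ℕ → ℕ) (r : ℕ) :
    csum d (r + 1) = csum d r + (d (r + 1) - 1) * q d r := by
  rw [csum, Finset.sum_Icc_succ_top (by omega)]; rfl

lemma csum_zero (d : ℕ → ℕ) : csum d 0 = 0 := by simp [csum]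

lemma csum_strictMono (h : Adm d p) : StrictMono (csum d) := by
  apply strictMono_nat_of_lt_succ
  intro r
  rw [csum_succ]
  have := lt_q h r
  have h2 := h.dj (r + 1) (by omega)
  have : 0 < (d (r + 1) - 1) * q d r := Nat.mul_pos (by omega) (by omega)
  omega

lemma csum_shift (h : Adm d p) (r : ℕ) :
    csum d (r + 1) = (d 1 - 1) + d 1 * csum (sh d) r := by
  induction r with
  | zero => simp [csum_succ, csum_zero, q_zero h]
  | succ r ih =>
    rw [csum_succ, ih, csum_succ, q_shift h]
    simp only [sh, Nat.add_eq_zero_iff, one_ne_zero, and_false, if_false]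
    ring

lemma s_succ (d : ℕ → ℕ) (p : ℕ → ℝ) (n : ℕ) :
    s d p n (n + 1) = ∏ j ∈ Finset.Icc 1 (zeta d n), p j := by simp [s]

lemma s_self (d : ℕ → ℕ) (p : ℕ → ℝ) (n : ℕ) : s d p n n = 1 - p 1 := by simp [s]

lemma s_carry (h : Adm d p) (n m r : ℕ) (hr : 1 ≤ r) (hz : r + 1 ≤ zeta d n)
    (hn : n = m + csum d r) :
    s d p n m = (1 - p (r + 1)) * ∏ j ∈ Finset.Icc 1 r, p j := by
  have h0 := csum_strictMono h (show 0 < r by omega)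
  have hex : ∃ r, 1 ≤ r ∧ r + 1 ≤ zeta d n ∧
      n = m + ∑ j ∈ Finset.Icc 1 r, (d j - 1) * q d (j - 1) := ⟨r, hr, hz, hn⟩
  have hch : hex.choose = r := by
    have h3 := hex.choose_spec.2.2
    apply (csum_strictMono h).injective
    have : n = m + csum d hex.choose := h3
    omega
  unfold s
  rw [if_neg (by omega), if_neg (by omega), dif_pos hex, hch]

lemma s_else (d : ℕ → ℕ) (p : ℕ → ℝ) (n m : ℕ) (h1 : m ≠ n + 1) (h2 : m ≠ n)
    (h3 : ∀ r, 1 ≤ r → r + 1 ≤ zeta d n → n ≠ m + csum d r) : s d p n m = 0 := by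
  unfold s
  rw [if_neg h1, if_neg h2, dif_neg]
  rintro ⟨r, a, b, c⟩
  exact h3 r a b c

lemma s_of_gt (d : ℕ → ℕ) (p : ℕ → ℝ) (n m : ℕ) (hm : n + 1 < m) : s d p n m = 0 :=
  s_else d p n m (by omega) (by omega) (fun r _ _ => by omega)

lemma s_nonneg (h : Adm d p) (n m : ℕ) : 0 ≤ s d p n m := by
  have hpr : ∀ r, 0 ≤ ∏ j ∈ Finset.Icc 1 r, p j := fun r =>
    Finset.prod_nonneg fun j hj => (h.pj j (Finset.mem_Icc.1 hj).1).1.le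
  by_cases h1 : m = n + 1
  · subst h1; rw [s_succ]; exact hpr _
  by_cases h2 : m = n
  · subst h2; rw [s_self]; linarith [(h.pj 1 le_rfl).2]
  by_cases h3 : ∃ r, 1 ≤ r ∧ r + 1 ≤ zeta d n ∧ n = m + csum d r
  · obtain ⟨r, a, b, c⟩ := h3
    rw [s_carry h n m r a b c]
    exact mul_nonneg (by linarith [(h.pj (r + 1) (by omega)).2]) (hpr _)
  · push Not at h3
    rw [s_else d p n m h1 h2 h3]

lemma prod_shift (p : ℕ → ℝ) (r : ℕ) :
    ∏ j ∈ Finset.Icc 1 (r + 1), p j = p 1 * ∏ j ∈ Finset.Icc 1 r, shp p j := by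
  induction r with
  | zero => simp
  | succ r ih =>
    rw [Finset.prod_Icc_succ_top (by omega), ih, Finset.prod_Icc_succ_top (by omega)]
    simp [shp, mul_assoc]

lemma s_rec_ne (h : Adm d p) (n m : ℕ) (hn : n % d 1 ≠ d 1 - 1) :
    s d p n m = (if m = n then 1 - p 1 else 0) + p 1 * (if m = n + 1 then 1 else 0) := by
  have hz := zeta_one h n hn
  by_cases h1 : m = n + 1
  · subst h1; rw [s_succ, hz]; simp
  by_cases h2 : m = n
  · subst h2; rw [s_self]; simp
  rw [s_else d p n m h1 h2 (by intro r; omega)]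
  simp [h1, h2]

lemma s_rec_eq (h : Adm d p) (n m : ℕ) (hn : n % d 1 = d 1 - 1) :
    s d p n m = (if m = n then 1 - p 1 else 0) +
      p 1 * (if m % d 1 = 0 then s (sh d) (shp p) (n / d 1) (m / d 1) else 0) := by
  have hz := zeta_shift h n hn
  have hD := h.dj 1 le_rfl
  obtain ⟨k, hk⟩ : ∃ k, k = n / d 1 := ⟨_, rfl⟩
  have hnk : n = (d 1 - 1) + d 1 * k := by rw [hk, ← hn, Nat.mod_add_div]
  rw [← hk] at hz ⊢
  have hz1 := one_le_zeta h.shift k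
  generalize hDD : d 1 = D at *
  by_cases h1 : m = n + 1
  · have hm : m = D * (k + 1) := by rw [mul_add]; omega
    have : m ≠ n := by omega
    rw [if_neg this, hm, Nat.mul_mod_right, if_pos rfl, Nat.mul_div_cancel_left _ (by omega),
      ← hm, h1, s_succ, s_succ, hz, prod_shift, zero_add]
  by_cases h2 : m = n
  · rw [h2, if_pos rfl, hn, if_neg (by omega), s_self]; simp
  rw [if_neg h2, zero_add]
  by_cases h3 : m % D = 0
  · rw [if_pos h3]
    obtain ⟨m', rfl⟩ := Nat.dvd_of_mod_eq_zero h3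
    rw [Nat.mul_div_cancel_left _ (by omega)]
    by_cases h4 : m' = k
    · subst h4
      rw [s_self, s_carry h n _ 1 le_rfl (by omega) (by
        rw [csum_shift h, csum_zero]; omega)]
      simp [shp, mul_comm]
    have h5 : m' ≠ k + 1 := by
      rintro rfl
      rw [mul_add] at h1; omega
    by_cases h6 : ∃ r, 1 ≤ r ∧ r + 1 ≤ zeta (sh d) k ∧ k = m' + csum (sh d) r
    · obtain ⟨r, a, b, c⟩ := h6
      rw [s_carry h.shift k m' r a b c, s_carry h n _ (r + 1) (by omega) (by omega) (by
        rw [csum_shift h, hDD, hnk, c]; ring), prod_shift]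
      simp only [shp]; ring
    · push Not at h6
      rw [s_else _ _ k m' h5 h4 h6, mul_zero]
      apply s_else _ _ _ _ h1 h2
      intro r hr hrz he
      obtain ⟨r', rfl⟩ : ∃ r', r = r' + 1 := ⟨r - 1, by omega⟩
      rw [csum_shift h, hDD] at he
      have he2 : D * k = D * (m' + csum (sh d) r') := by rw [mul_add]; omega
      have he3 := Nat.eq_of_mul_eq_mul_left (by omega) he2
      rcases Nat.eq_zero_or_pos r' with rfl | hr'
      · rw [csum_zero] at he3; omega
      · exact h6 r' hr' (by omega) he3
  · rw [if_neg h3, mul_zero]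
    apply s_else _ _ _ _ h1 h2
    intro r hr hrz he
    obtain ⟨r', rfl⟩ : ∃ r', r = r' + 1 := ⟨r - 1, by omega⟩
    rw [csum_shift h, hDD] at he
    apply h3
    have he2 : D * k = m + D * csum (sh d) r' := by omega
    have : m = D * (k - csum (sh d) r') := by rw [Nat.mul_sub]; omega
    rw [this, Nat.mul_mod_right]

lemma col_sum (N : ℕ) : ∀ (d : ℕ → ℕ) (p : ℕ → ℝ), Adm d p → ∀ m,
    ∑ n ∈ Finset.range N, s d p n m ≤ 1 := by
  induction N using Nat.strong_induction_on with
  | _ N ih =>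
  intro d p h m
  rcases Nat.eq_zero_or_pos N with rfl | hN
  · simp
  have hD := h.dj 1 le_rfl
  have hp1 := h.pj 1 le_rfl
  set g : ℕ → ℝ := fun n => if n % d 1 = d 1 - 1 then
    (if m % d 1 = 0 then s (sh d) (shp p) (n / d 1) (m / d 1) else 0) else
    (if m = n + 1 then 1 else 0) with hg
  have e1 : ∀ n, s d p n m = (if m = n then 1 - p 1 else 0) + p 1 * g n := by
    intro n
    by_cases hn : n % d 1 = d 1 - 1
    · rw [s_rec_eq h n m hn]; simp [hg, hn]
    · rw [s_rec_ne h n m hn]; simp [hg, hn]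
  simp only [e1, Finset.sum_add_distrib, ← Finset.mul_sum]
  have a1 : ∑ n ∈ Finset.range N, (if m = n then 1 - p 1 else 0) ≤ 1 - p 1 := by
    rw [Finset.sum_ite_eq]
    split_ifs
    · exact le_rfl
    · linarith [hp1.2]
  have a2 : ∑ n ∈ Finset.range N, g n ≤ 1 := by
    by_cases hm : m % d 1 = 0
    · have e2 : ∀ n, g n = if n % d 1 = d 1 - 1 then
          s (sh d) (shp p) (n / d 1) (m / d 1) else 0 := by
        intro n
        simp only [hg, hm, if_true]
        by_cases hn : n % d 1 = d 1 - 1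
        · simp [hn]
        · rw [if_neg hn, if_neg hn, if_neg]
          rintro rfl
          apply hn
          obtain ⟨k, hk⟩ := Nat.dvd_of_mod_eq_zero hm
          obtain ⟨k', rfl⟩ : ∃ k', k = k' + 1 := ⟨k - 1, by
            rcases Nat.eq_zero_or_pos k with rfl | h0
            · simp at hk
            · omega⟩
          rw [mul_add] at hk
          have : n = (d 1 - 1) + d 1 * k' := by omega
          rw [this, Nat.add_mul_mod_self_left, Nat.mod_eq_of_lt (by omega)]
      simp only [e2]
      rw [← Finset.sum_filter]
      have hinj : Set.InjOn (fun n => n / d 1)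
          ((Finset.range N).filter (fun n => n % d 1 = d 1 - 1) : Finset ℕ) := by
        intro x hx y hy hxy
        simp only [Finset.coe_filter, Set.mem_ofPred_eq] at hx hy hxy
        rw [← Nat.mod_add_div x (d 1), ← Nat.mod_add_div y (d 1), hx.2, hy.2, hxy]
      rw [← Finset.sum_image (f := fun k => s (sh d) (shp p) k (m / d 1)) hinj]
      refine le_trans (Finset.sum_le_sum_of_subset_of_nonneg ?_ ?_)
        (ih (N / d 1) (Nat.div_lt_self hN hD) _ _ h.shift (m / d 1))
      · intro k hk
        simp only [Finset.mem_image, Finset.mem_filter, Finset.mem_range] at hk ⊢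
        obtain ⟨n, ⟨h1, h2⟩, rfl⟩ := hk
        have := Nat.mod_add_div n (d 1)
        rw [Nat.lt_iff_add_one_le, Nat.le_div_iff_mul_le (by omega), add_mul, mul_comm]
        omega
      · intro k _ _
        exact s_nonneg h.shift _ _
    · have e2 : ∀ n, g n ≤ if n = m - 1 then 1 else 0 := by
        intro n
        simp only [hg, hm, if_false]
        split_ifs <;> first | omega | norm_num
      refine (Finset.sum_le_sum fun n _ => e2 n).trans ?_
      rw [Finset.sum_ite_eq']
      split_ifs <;> norm_num
  nlinarith [hp1.1]


/-- the transition operator on all sequences -/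
def L (d : ℕ → ℕ) (p : ℕ → ℝ) : Module.End ℂ (ℕ → ℂ) where
  toFun w n := ∑ m ∈ Finset.range (n + 2), (s d p n m : ℂ) * w m
  map_add' u v := by
    ext n; simp [mul_add, Finset.sum_add_distrib]
  map_smul' c u := by
    ext n; simp [Finset.mul_sum, mul_left_comm]

lemma L_apply (d : ℕ → ℕ) (p : ℕ → ℝ) (w : ℕ → ℂ) (n : ℕ) :
    L d p w n = ∑ m ∈ Finset.range (n + 2), (s d p n m : ℂ) * w m := rfl

lemma L_eq_tsum (d : ℕ → ℕ) (p : ℕ → ℝ) (w : ℕ → ℂ) (n : ℕ) :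
    L d p w n = ∑' m, (s d p n m : ℂ) * w m := by
  rw [L_apply, tsum_eq_sum]
  intro m hm
  rw [s_of_gt d p n m (by simp at hm; omega)]
  simp

lemma L_rec_ne (h : Adm d p) (w : ℕ → ℂ) (n : ℕ) (hn : n % d 1 ≠ d 1 - 1) :
    L d p w n = (1 - (p 1 : ℂ)) * w n + p 1 * w (n + 1) := by
  rw [L_apply, Finset.sum_range_succ, Finset.sum_range_succ, Finset.sum_eq_zero]
  · rw [s_rec_ne h _ _ hn, s_rec_ne h _ _ hn]
    simp
  · intro m hm
    have hm := Finset.mem_range.1 hm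
    rw [s_rec_ne h _ _ hn, if_neg (by omega), if_neg (by omega)]
    simp

lemma L_rec_eq (h : Adm d p) (w : ℕ → ℂ) (n : ℕ) (hn : n % d 1 = d 1 - 1) :
    L d p w n = (1 - (p 1 : ℂ)) * w n +
      p 1 * L (sh d) (shp p) (fun b => w (d 1 * b)) (n / d 1) := by
  have hD := h.dj 1 le_rfl
  obtain ⟨k, hk⟩ : ∃ k, k = n / d 1 := ⟨_, rfl⟩
  have hnk : n = (d 1 - 1) + d 1 * k := by rw [hk, ← hn, Nat.mod_add_div]
  have e1 : ∀ m, (s d p n m : ℂ) * w m = (if m = n then (1 - (p 1 : ℂ)) * w m else 0) +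
      p 1 * (if m % d 1 = 0 then (s (sh d) (shp p) k (m / d 1) : ℂ) * w m else 0) := by
    intro m
    rw [s_rec_eq h n m hn, ← hk]
    push_cast
    split_ifs <;> simp <;> ring
  rw [L_apply, Finset.sum_congr rfl (fun m _ => e1 m), Finset.sum_add_distrib,
    ← Finset.mul_sum, Finset.sum_ite_eq', if_pos (by simp), ← hk, L_apply]
  congr 2
  have hinj : Set.InjOn (fun b => d 1 * b) (Finset.range (k + 2) : Set ℕ) := by
    intro x _ y _ hxy
    exact Nat.eq_of_mul_eq_mul_left (by omega) hxy
  have e2 : ∑ b ∈ Finset.range (k + 2), (s (sh d) (shp p) k b : ℂ) * w (d 1 * b) =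
      ∑ m ∈ (Finset.range (k + 2)).image (fun b => d 1 * b),
        (if m % d 1 = 0 then (s (sh d) (shp p) k (m / d 1) : ℂ) * w m else 0) := by
    rw [Finset.sum_image hinj]
    refine Finset.sum_congr rfl fun b _ => ?_
    rw [Nat.mul_mod_right, if_pos rfl, Nat.mul_div_cancel_left _ (by omega)]
  rw [e2]
  symm
  apply Finset.sum_subset
  · intro m hm
    simp only [Finset.mem_image, Finset.mem_range] at hm ⊢
    obtain ⟨b, hb, rfl⟩ := hm
    have : d 1 * b ≤ d 1 * (k + 1) := Nat.mul_le_mul_left _ (by omega)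
    rw [mul_add] at this
    omega
  · intro m hm hm2
    rw [if_neg]
    intro h0
    apply hm2
    obtain ⟨b, rfl⟩ := Nat.dvd_of_mod_eq_zero h0
    refine Finset.mem_image.2 ⟨b, ?_, rfl⟩
    rw [Finset.mem_range] at hm ⊢
    by_contra hb
    have : d 1 * (k + 2) ≤ d 1 * b := Nat.mul_le_mul_left _ (by omega)
    rw [mul_add] at this
    omega

lemma L_one (n : ℕ) : ∀ (d : ℕ → ℕ) (p : ℕ → ℝ), Adm d p →
    L d p (fun _ => 1) n = 1 := by
  induction n using Nat.strong_induction_on with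
  | _ n ih =>
  intro d p h
  have hD := h.dj 1 le_rfl
  by_cases hn : n % d 1 = d 1 - 1
  · rw [L_rec_eq h _ n hn, ih (n / d 1) _ _ _ h.shift]
    · ring
    · apply Nat.div_lt_self _ hD
      rcases Nat.eq_zero_or_pos n with rfl | h0
      · simp at hn; omega
      · exact h0
  · rw [L_rec_ne h _ n hn]; ring

lemma row_sum (h : Adm d p) (n : ℕ) : ∑ m ∈ Finset.range (n + 2), s d p n m = 1 := by
  have := L_one n d p h
  rw [L_apply] at this
  simp only [mul_one] at this
  exact_mod_cast this

/-- slices along residue classes -/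
def slice (Q a : ℕ) : (ℕ → ℂ) →ₗ[ℂ] (ℕ → ℂ) where
  toFun w b := w (a + Q * b)
  map_add' _ _ := rfl
  map_smul' _ _ := rfl

lemma slice_apply (Q a : ℕ) (w : ℕ → ℂ) (b : ℕ) : slice Q a w b = w (a + Q * b) := rfl

/-- the operator `(S - (1 - p₁)) / p₁` -/
def A (d : ℕ → ℕ) (p : ℕ → ℝ) : Module.End ℂ (ℕ → ℂ) :=
  (L d p - algebraMap ℂ _ (1 - (p 1 : ℂ))) * algebraMap ℂ _ ((p 1 : ℂ)⁻¹)

lemma A_apply (w : ℕ → ℂ) (n : ℕ) :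
    A d p w n = (p 1 : ℂ)⁻¹ * (L d p w n - (1 - (p 1 : ℂ)) * w n) := by
  simp only [A, Module.End.mul_apply, Module.algebraMap_end_apply, LinearMap.sub_apply,
    map_smul, Pi.sub_apply, Pi.smul_apply, smul_eq_mul]

lemma A_ne (h : Adm d p) (w : ℕ → ℂ) (a b : ℕ) (ha : a + 1 < d 1) :
    A d p w (a + d 1 * b) = w (a + 1 + d 1 * b) := by
  have : (p 1 : ℂ) ≠ 0 := by exact_mod_cast (h.pj 1 le_rfl).1.ne'
  rw [A_apply, L_rec_ne h]
  · field_simp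
    rw [add_right_comm]
    ring
  · rw [Nat.add_mul_mod_self_left, Nat.mod_eq_of_lt (by omega)]; omega

lemma A_eq (h : Adm d p) (w : ℕ → ℂ) (a b : ℕ) (ha : a + 1 = d 1) :
    A d p w (a + d 1 * b) = L (sh d) (shp p) (slice (d 1) 0 w) b := by
  have : (p 1 : ℂ) ≠ 0 := by exact_mod_cast (h.pj 1 le_rfl).1.ne'
  have hs : slice (d 1) 0 w = fun b => w (d 1 * b) := by
    ext b; simp [slice_apply]
  rw [A_apply, L_rec_eq h, hs]
  · rw [Nat.add_mul_div_left _ _ (by omega), Nat.div_eq_of_lt (by omega), zero_add]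
    field_simp
    ring
  · rw [Nat.add_mul_mod_self_left, Nat.mod_eq_of_lt (by omega)]; omega

lemma A_pow (h : Adm d p) (k : ℕ) : k ≤ d 1 → ∀ (w : ℕ → ℂ) (a b : ℕ), a < d 1 →
    (A d p ^ k) w (a + d 1 * b) = if a + k < d 1 then w (a + k + d 1 * b)
      else L (sh d) (shp p) (slice (d 1) (a + k - d 1) w) b := by
  induction k with
  | zero => intro _ w a b ha; simp [ha]
  | succ k ih =>
    intro hk w a b ha
    rw [pow_succ, Module.End.mul_apply, ih (by omega) _ a b ha]
    by_cases h1 : a + k + 1 < d 1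
    · rw [if_pos (by omega), if_pos (by omega), A_ne h _ _ _ h1, add_assoc a k 1]
    by_cases h2 : a + k + 1 = d 1
    · rw [if_pos (by omega), if_neg (by omega), A_eq h _ _ _ h2, ← add_assoc a k 1, h2,
        Nat.sub_self]
    rw [if_neg (by omega), if_neg (by omega)]
    have hsl : slice (d 1) (a + k - d 1) (A d p w) = slice (d 1) (a + (k + 1) - d 1) w := by
      ext c
      rw [slice_apply, slice_apply, A_ne h _ _ _ (by omega)]
      congr 2
      omega
    rw [hsl]

lemma slice_A_pow (h : Adm d p) (a : ℕ) (ha : a < d 1) (w : ℕ → ℂ) :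
    slice (d 1) a ((A d p ^ d 1) w) = L (sh d) (shp p) (slice (d 1) a w) := by
  ext b
  rw [slice_apply, A_pow h _ le_rfl w a b ha, if_neg (by omega), Nat.add_sub_cancel]

open Polynomial in
/-- the polynomial `f_j` -/
def F (d : ℕ → ℕ) (p : ℕ → ℝ) (j : ℕ) : ℂ[X] :=
  ((X - C (1 - (p j : ℂ))) * C ((p j : ℂ)⁻¹)) ^ d j

open Polynomial in
/-- the polynomial of `ftil j` -/
def P (d : ℕ → ℕ) (p : ℕ → ℝ) : ℕ → ℂ[X]
  | 0 => X
  | j + 1 => (F d p (j + 1)).comp (P d p j)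

lemma eval_P (d : ℕ → ℕ) (p : ℕ → ℝ) (z : ℂ) (j : ℕ) : (P d p j).eval z = ftil d p j z := by
  induction j with
  | zero => simp [P, ftil]
  | succ j ih => simp [P, F, ftil, f, ih, div_eq_mul_inv]

lemma aeval_F_one (d : ℕ → ℕ) (p : ℕ → ℝ) :
    Polynomial.aeval (L d p) (F d p 1) = A d p ^ d 1 := by
  simp [F, A]

/-- intertwining passes to polynomials -/
lemma intertwine {V W : Type*} [AddCommGroup V] [Module ℂ V] [AddCommGroup W] [Module ℂ W]
    (g : V →ₗ[ℂ] W) (S : Module.End ℂ V) (T : Module.End ℂ W)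
    (hST : ∀ v, g (S v) = T (g v)) (Q : Polynomial ℂ) (v : V) :
    g (Polynomial.aeval S Q v) = Polynomial.aeval T Q (g v) := by
  induction Q using Polynomial.induction_on' with
  | add a b ha hb => simp [ha, hb]
  | monomial n c =>
    have : ∀ n v, g ((S ^ n) v) = (T ^ n) (g v) := by
      intro n
      induction n with
      | zero => simp
      | succ n ih => intro v; rw [pow_succ, pow_succ]; simp [ih, hST]
    simp [Polynomial.aeval_monomial, this]

/-- iterated shift -/
def shn (d : ℕ → ℕ) (k : ℕ) : ℕ → ℕ := sh^[k] d

/-- iterated shift -/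
def shpn (p : ℕ → ℝ) (k : ℕ) : ℕ → ℝ := shp^[k] p

lemma shn_succ (d : ℕ → ℕ) (k : ℕ) : shn d (k + 1) = sh (shn d k) :=
  Function.iterate_succ_apply' ..

lemma shpn_succ (p : ℕ → ℝ) (k : ℕ) : shpn p (k + 1) = shp (shpn p k) :=
  Function.iterate_succ_apply' ..

lemma adm_n (h : Adm d p) (k : ℕ) : Adm (shn d k) (shpn p k) := by
  induction k with
  | zero => exact h
  | succ k ih => rw [shn_succ, shpn_succ]; exact ih.shift

lemma shn_apply (d : ℕ → ℕ) (k j : ℕ) : shn d k (j + 1) = d (k + j + 1) := by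
  induction k generalizing j with
  | zero => simp [shn]
  | succ k ih => rw [shn_succ]; simp [sh, ih]; congr 1; omega

lemma shpn_apply (p : ℕ → ℝ) (k j : ℕ) : shpn p k (j + 1) = p (k + j + 1) := by
  induction k generalizing j with
  | zero => simp [shpn]
  | succ k ih => rw [shpn_succ]; simp [shp, ih]; congr 1; omega

lemma slice_P (h : Adm d p) (j : ℕ) : ∀ a < q d j, ∀ w : ℕ → ℂ,
    slice (q d j) a (Polynomial.aeval (L d p) (P d p j) w) =
      L (shn d j) (shpn p j) (slice (q d j) a w) := by
  induction j with
  | zero =>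
    intro a ha w
    rw [q_zero h] at *
    have : a = 0 := by omega
    subst this
    ext b
    simp [P, slice_apply, shn, shpn, L_apply]
  | succ j ih =>
    intro a ha w
    have hF : F d p (j + 1) = F (shn d j) (shpn p j) 1 := by
      have h1 := shn_apply d j 0
      have h2 := shpn_apply p j 0
      simp only [zero_add, add_zero] at h1 h2
      simp [F, h1, h2]
    have hd1 : shn d j 1 = d (j + 1) := shn_apply d j 0
    have hq : 0 < q d j := (Nat.zero_le _).trans_lt (lt_q h j)
    have hs : ∀ u : ℕ → ℂ, slice (q d (j + 1)) a u =
        slice (shn d j 1) (a / q d j) (slice (q d j) (a % q d j) u) := by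
      intro u
      ext b
      simp only [slice_apply]
      congr 1
      rw [q_succ, hd1, mul_add, ← add_assoc, Nat.mod_add_div, mul_assoc]
    rw [hs, hs, P, Polynomial.aeval_comp,
      intertwine (slice (q d j) (a % q d j)) _ _ (ih _ (Nat.mod_lt _ hq)), hF, aeval_F_one,
      slice_A_pow (adm_n h j), shn_succ, shpn_succ]
    rw [q_succ] at ha
    rw [hd1]
    exact Nat.div_lt_of_lt_mul ha

/-- forgetting continuity, as an algebra homomorphism -/
def toEnd (X : Type*) [NormedAddCommGroup X] [NormedSpace ℂ X] :
    (X →L[ℂ] X) →ₐ[ℂ] Module.End ℂ X where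
  toFun T := T
  map_one' := rfl
  map_mul' _ _ := rfl
  map_zero' := rfl
  map_add' _ _ := rfl
  commutes' _ := rfl

theorem key (h : Adm d p) {X : Type*} [NormedAddCommGroup X] [NormedSpace ℂ X] [CompleteSpace X]
    (φ : X →ₗ[ℂ] (ℕ → ℂ)) (T : X →L[ℂ] X)
    (hT : ∀ w n, φ (T w) n = ∑' m : ℕ, (s d p n m : ℂ) * φ w m)
    (hc : ∀ (d' : ℕ → ℕ) (p' : ℕ → ℝ), Adm d' p' → ∀ Q, 0 < Q → ∀ u v : X,
      (∀ a < Q, slice Q a (φ v) = L d' p' (slice Q a (φ u))) → ‖v‖ ≤ ‖u‖) :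
    spectrum ℂ T ⊆ E d p := by
  intro z hz
  have hb : ∀ j, ‖ftil d p j z‖ ≤ 1 := by
    intro j
    have h1 : ftil d p j z ∈ spectrum ℂ (Polynomial.aeval T (P d p j)) :=
      spectrum.subset_polynomial_aeval T (P d p j) ⟨z, hz, eval_P d p z j⟩
    have h2 := spectrum.norm_le_norm_mul_of_mem h1
    have h3 : ‖Polynomial.aeval T (P d p j)‖ ≤ 1 := by
      refine ContinuousLinearMap.opNorm_le_bound _ zero_le_one fun w => ?_
      rw [one_mul]
      refine hc _ _ (adm_n h j) (q d j) ((Nat.zero_le _).trans_lt (lt_q h j)) _ _ fun a ha => ?_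
      rw [← slice_P h j a ha]
      congr 1
      have h4 := intertwine φ (T : X →ₗ[ℂ] X) (L d p) (fun v => by
        ext n; rw [L_eq_tsum]; exact hT v n) (P d p j) w
      rw [← h4]
      congr 1
      have h5 := Polynomial.aeval_algHom_apply
        (toEnd X) T (P d p j)
      exact (LinearMap.congr_fun h5 w).symm
    have h6 : ‖(1 : X →L[ℂ] X)‖ ≤ 1 := ContinuousLinearMap.norm_id_le
    calc _ ≤ _ := h2
      _ ≤ 1 * 1 := mul_le_mul h3 h6 (norm_nonneg _) zero_le_one
      _ = 1 := one_mul 1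
  refine lt_of_le_of_lt (Filter.limsup_le_of_le (a := 1) (by isBoundedDefault) ?_) ENNReal.one_lt_top
  refine Filter.Eventually.of_forall fun j => ?_
  exact_mod_cast hb j

lemma L_norm_le (h : Adm d p) (w : ℕ → ℂ) (n : ℕ) :
    ‖L d p w n‖ ≤ ∑ m ∈ Finset.range (n + 2), s d p n m * ‖w m‖ := by
  rw [L_apply]
  refine (norm_sum_le _ _).trans (Finset.sum_le_sum fun m _ => ?_)
  rw [norm_mul, Complex.norm_real, Real.norm_of_nonneg (s_nonneg h n m)]

lemma L_bound (h : Adm d p) (w : ℕ → ℂ) (C : ℝ) (hw : ∀ m, ‖w m‖ ≤ C) (n : ℕ) :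
    ‖L d p w n‖ ≤ C := by
  calc _ ≤ _ := L_norm_le h w n
    _ ≤ ∑ m ∈ Finset.range (n + 2), s d p n m * C :=
        Finset.sum_le_sum fun m _ => mul_le_mul_of_nonneg_left (hw m) (s_nonneg h n m)
    _ = C := by rw [← Finset.sum_mul, row_sum h, one_mul]

lemma slice_bound (h : Adm d p) (Q : ℕ) (hQ : 0 < Q) (u v : ℕ → ℂ)
    (huv : ∀ a < Q, slice Q a v = L d p (slice Q a u)) (C : ℝ) (hu : ∀ m, ‖u m‖ ≤ C) (n : ℕ) :
    ‖v n‖ ≤ C := by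
  have := congrFun (huv (n % Q) (Nat.mod_lt _ hQ)) (n / Q)
  rw [slice_apply, Nat.mod_add_div] at this
  rw [this]
  exact L_bound h _ C (fun m => hu _) _

lemma L_pow_le (h : Adm d p) (w : ℕ → ℂ) (r : ℝ) (hr : 1 ≤ r) (n : ℕ) :
    ‖L d p w n‖ₑ ^ r ≤ ∑' m, ENNReal.ofReal (s d p n m) * ‖w m‖ₑ ^ r := by
  have h1 : ‖L d p w n‖ₑ ≤
      ∑ m ∈ Finset.range (n + 2), ENNReal.ofReal (s d p n m) * ‖w m‖ₑ := by
    rw [L_apply]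
    refine (enorm_sum_le _ _).trans (Finset.sum_le_sum fun m _ => ?_)
    rw [enorm_mul, ← ofReal_norm, Complex.norm_real,
      Real.norm_of_nonneg (s_nonneg h n m)]
  refine (ENNReal.rpow_le_rpow h1 (by linarith)).trans ?_
  refine (ENNReal.rpow_arith_mean_le_arith_mean_rpow _ _ _ ?_ hr).trans
    (ENNReal.sum_le_tsum _)
  rw [← ENNReal.ofReal_sum_of_nonneg (fun m _ => s_nonneg h n m), row_sum h]
  simp

lemma L_tsum_le (h : Adm d p) (w : ℕ → ℂ) (r : ℝ) (hr : 1 ≤ r) :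
    ∑' n, ‖L d p w n‖ₑ ^ r ≤ ∑' n, ‖w n‖ₑ ^ r := by
  calc _ ≤ ∑' n, ∑' m, ENNReal.ofReal (s d p n m) * ‖w m‖ₑ ^ r :=
        ENNReal.tsum_le_tsum fun n => L_pow_le h w r hr n
    _ = ∑' m, (∑' n, ENNReal.ofReal (s d p n m)) * ‖w m‖ₑ ^ r := by
        rw [ENNReal.tsum_comm]
        simp_rw [ENNReal.tsum_mul_right]
    _ ≤ ∑' m, 1 * ‖w m‖ₑ ^ r := by
        refine ENNReal.tsum_le_tsum fun m => mul_le_mul_left ?_ _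
        rw [ENNReal.tsum_eq_iSup_nat]
        refine iSup_le fun N => ?_
        rw [← ENNReal.ofReal_sum_of_nonneg (fun n _ => s_nonneg h n m)]
        exact ENNReal.ofReal_le_one.2 (col_sum N d p h m)
    _ = _ := by simp

lemma tsum_slice (Q : ℕ) (hQ : 0 < Q) (g : ℕ → ℝ≥0∞) :
    ∑' n, g n = ∑' a : Fin Q, ∑' b, g (a + Q * b) := by
  have : NeZero Q := ⟨hQ.ne'⟩
  rw [← (Nat.divModEquiv Q).symm.tsum_eq, ENNReal.tsum_prod', ENNReal.tsum_comm]
  simp [Nat.divModEquiv, add_comm, mul_comm]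

lemma slice_tsum (h : Adm d p) (Q : ℕ) (hQ : 0 < Q) (u v : ℕ → ℂ)
    (huv : ∀ a < Q, slice Q a v = L d p (slice Q a u)) (r : ℝ) (hr : 1 ≤ r) :
    ∑' n, ‖v n‖ₑ ^ r ≤ ∑' n, ‖u n‖ₑ ^ r := by
  rw [tsum_slice Q hQ, tsum_slice Q hQ]
  refine ENNReal.tsum_le_tsum fun a => ?_
  have h1 := L_tsum_le h (slice Q a u) r hr
  rw [← huv a a.2] at h1
  exact h1

/-- evaluation on `c₀` -/
def φ0 : C₀(ℕ, ℂ) →ₗ[ℂ] (ℕ → ℂ) where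
  toFun w n := w n
  map_add' _ _ := rfl
  map_smul' _ _ := rfl

/-- evaluation on `c` -/
def φc : C(OnePoint ℕ, ℂ) →ₗ[ℂ] (ℕ → ℂ) where
  toFun w n := w (n : OnePoint ℕ)
  map_add' _ _ := rfl
  map_smul' _ _ := rfl

/-- evaluation on `l^α` -/
def φl (α : ℝ≥0∞) : lp (fun _ : ℕ => ℂ) α →ₗ[ℂ] (ℕ → ℂ) where
  toFun w n := w n
  map_add' _ _ := rfl
  map_smul' _ _ := rfl

/-- for `Ω ∈ {c₀, c, l^α (1 ≤ α < ∞), l^∞}`, the spectrum of the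
transition operator `S` on `Ω` is contained in `E`.  Here `c` is modelled as
`C(OnePoint ℕ, ℂ)` and the operators are given by the transition matrix. -/
theorem stmt5 (d : ℕ → ℕ) (p : ℕ → ℝ)
    (hd0 : d 0 = 1) (hd : ∀ j, 1 ≤ j → 2 ≤ d j)
    (hp : ∀ j, 1 ≤ j → p j ∈ Set.Ioc (0 : ℝ) 1)
    (α : ℝ≥0∞) [Fact (1 ≤ α)] (hα : α ≠ ⊤)
    (T0 : C₀(ℕ, ℂ) →L[ℂ] C₀(ℕ, ℂ))
    (hT0 : ∀ (w : C₀(ℕ, ℂ)) (n : ℕ), T0 w n = ∑' m : ℕ, (s d p n m : ℂ) * w m)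
    (Tc : C(OnePoint ℕ, ℂ) →L[ℂ] C(OnePoint ℕ, ℂ))
    (hTc : ∀ (w : C(OnePoint ℕ, ℂ)) (n : ℕ),
      Tc w (n : OnePoint ℕ) = ∑' m : ℕ, (s d p n m : ℂ) * w (m : OnePoint ℕ))
    (Ta : lp (fun _ : ℕ => ℂ) α →L[ℂ] lp (fun _ : ℕ => ℂ) α)
    (hTa : ∀ (w : lp (fun _ : ℕ => ℂ) α) (n : ℕ),
      Ta w n = ∑' m : ℕ, (s d p n m : ℂ) * w m)
    (Tinf : lp (fun _ : ℕ => ℂ) ⊤ →L[ℂ] lp (fun _ : ℕ => ℂ) ⊤)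
    (hTinf : ∀ (w : lp (fun _ : ℕ => ℂ) ⊤) (n : ℕ),
      Tinf w n = ∑' m : ℕ, (s d p n m : ℂ) * w m) :
    spectrum ℂ T0 ⊆ E d p ∧ spectrum ℂ Tc ⊆ E d p ∧
      spectrum ℂ Ta ⊆ E d p ∧ spectrum ℂ Tinf ⊆ E d p := by

  have h : Adm d p := ⟨hd0, hd, hp⟩
  refine ⟨?_, ?_, ?_, ?_⟩
  · refine key h φ0 T0 hT0 ?_
    intro d' p' h' Q hQ u v huv
    have := slice_bound h' Q hQ _ _ huv ‖u‖ (fun m => u.toBCF.norm_coe_le_norm m)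
    exact (BoundedContinuousFunction.norm_le (f := v.toBCF) (norm_nonneg _)).2 this
  · refine key h φc Tc hTc ?_
    intro d' p' h' Q hQ u v huv
    have h1 := slice_bound h' Q hQ _ _ huv ‖u‖ (fun m => u.norm_coe_le_norm m)
    rw [ContinuousMap.norm_le _ (norm_nonneg _)]
    intro x
    have hcl : IsClosed {x : OnePoint ℕ | ‖v x‖ ≤ ‖u‖} :=
      isClosed_le (by fun_prop) continuous_const
    have hden := OnePoint.denseRange_coe (X := ℕ)
    exact hden.induction_on (p := fun x => ‖v x‖ ≤ ‖u‖) x hcl h1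
  · refine key h (φl α) Ta hTa ?_
    intro d' p' h' Q hQ u v huv
    have hα1 : (1 : ℝ≥0∞) ≤ α := Fact.out
    have hr : 1 ≤ α.toReal := by
      rw [← ENNReal.toReal_one]
      exact ENNReal.toReal_mono hα hα1
    have h0 : 0 < α.toReal := by linarith
    have h1 := slice_tsum h' Q hQ _ _ huv α.toReal hr
    have e : ∀ x : ℂ, ‖x‖ₑ ^ α.toReal = ENNReal.ofReal (‖x‖ ^ α.toReal) := by
      intro x
      rw [← ofReal_norm, ENNReal.ofReal_rpow_of_nonneg (norm_nonneg _) h0.le]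
    refine lp.norm_le_of_forall_sum_le h0 (norm_nonneg _) fun t => ?_
    rw [lp.norm_rpow_eq_tsum h0]
    have hnn : ∀ (w : lp (fun _ : ℕ => ℂ) α) n, 0 ≤ ‖w n‖ ^ α.toReal := fun w n => by positivity
    rw [← ENNReal.ofReal_le_ofReal_iff (tsum_nonneg (hnn u)),
      ENNReal.ofReal_tsum_of_nonneg (hnn u) ((lp.memℓp u).summable h0),
      ENNReal.ofReal_sum_of_nonneg (fun n _ => hnn v n)]
    simp only [← e]
    exact (ENNReal.sum_le_tsum t).trans h1
  · refine key h (φl ⊤) Tinf hTinf ?_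
    intro d' p' h' Q hQ u v huv
    have h1 := slice_bound h' Q hQ _ _ huv ‖u‖
      (fun m => lp.norm_apply_le_norm ENNReal.top_ne_zero u m)
    exact lp.norm_le_of_forall_le (norm_nonneg _) h1

end AMFC
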